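/- arXiv:2605.02375 — 2 statements merged into one kernel-verified Lean document; each statement's English description precedes it below -/
import Mathlib

section
/- For every λ ∈ ℝ, the forward KL divergence from the filtered model to the tilted distribution equals KL(p*‖p_λ) = log(1 + (A₀/A₁)·e^{−λ}); in particular, KL(p*‖p_λ) → 0 as λ → +∞. -/
noncomputable section

open scoped BigOperators Classical

variable {Y : Type*} [Countable Y]

/-- `q` is a probability mass function on the countable set `Y`. -/
def IsPMF (q : Y → ℝ) : Prop := (∀ y, 0 ≤ q y) ∧ HasSum q 1

/-- Kullback–Leibler divergence `KL(q‖p) = Σ_y q(y)·log(q(y)/p(y))`, with value `+∞`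
when `q` is not absolutely continuous with respect to `p` (or the series fails to sum). -/
def KL (q p : Y → ℝ) : EReal :=
  if (∀ y, p y = 0 → q y = 0) ∧ Summable (fun y => q y * Real.log (q y / p y))
  then ((∑' y, q y * Real.log (q y / p y) : ℝ) : EReal)
  else ⊤

/-- The mass `a(Y₁)` that the base model assigns to the valid set `Y₁ = {y | v y = 1}`. -/
def A1 (a v : Y → ℝ) : ℝ := ∑' y : {z : Y // v z = 1}, a y.1

/-- `A₀ := 1 − A₁`. -/
def A0 (a v : Y → ℝ) : ℝ := 1 - A1 a v

/-- The filtered model `p*(y) = a(y)/A₁` on `Y₁`, and `0` on `Y₀`. -/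
def pstar (a v : Y → ℝ) (y : Y) : ℝ :=
  if v y = 1 then a y / A1 a v else 0

/-- The tilted distribution `p_λ(y) = a(y)·e^{λ·v(y)}/Z_λ` with `Z_λ = A₀ + A₁·e^λ`. -/
def plam (a v : Y → ℝ) (lam : ℝ) (y : Y) : ℝ :=
  a y * Real.exp (lam * v y) / (A0 a v + A1 a v * Real.exp lam)

open Filter Topology

lemma hasSum_pstar {X : Type*} {a v : X → ℝ} (ha : Summable a) (h : A1 a v ≠ 0) :
    HasSum (pstar a v) 1 := by
  have hsum : HasSum ({y | v y = 1}.indicator a) (A1 a v) := by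
    have hA : A1 a v = ∑' y, {y | v y = 1}.indicator a y := tsum_subtype {y | v y = 1} a
    exact hA ▸ (ha.indicator _).hasSum
  have hdiv := hsum.div_const (A1 a v)
  rw [div_self h] at hdiv
  have hfun : pstar a v = fun y => {y | v y = 1}.indicator a y / A1 a v := by
    funext y
    by_cases hy : v y = 1 <;> simp [pstar, hy]
  exact hfun ▸ hdiv

/-- On the valid set the likelihood ratio `p*(y) / p_λ(y)` is constant. -/
lemma pstar_div_plam {X : Type*} {a v : X → ℝ} {y : X} (ha : a y ≠ 0) (hy : v y = 1)
    (h : A1 a v ≠ 0) (lam : ℝ) :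
    pstar a v y / plam a v lam y = 1 + (A0 a v / A1 a v) * Real.exp (-lam) := by
  have he := (Real.exp_pos lam).ne'
  rw [pstar, plam, if_pos hy, hy, mul_one, Real.exp_neg, div_div_eq_mul_div]
  field_simp
  ring

lemma KL_pstar_plam {X : Type*} {a v : X → ℝ} (ha : Summable a) (hfull : ∀ y, 0 < a y)
    (hA1 : 0 < A1 a v) (hA0 : 0 < A0 a v) (lam : ℝ) :
    KL (pstar a v) (plam a v lam)
      = ((Real.log (1 + (A0 a v / A1 a v) * Real.exp (-lam)) : ℝ) : EReal) := by
  have hterm : (fun y => pstar a v y * Real.log (pstar a v y / plam a v lam y))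
      = fun y => pstar a v y * Real.log (1 + (A0 a v / A1 a v) * Real.exp (-lam)) := by
    funext y
    by_cases hy : v y = 1
    · rw [pstar_div_plam (hfull y).ne' hy hA1.ne']
    · simp [pstar, hy]
  have hsum := (hasSum_pstar ha hA1.ne').mul_right
    (Real.log (1 + (A0 a v / A1 a v) * Real.exp (-lam)))
  have hpos (y : X) : plam a v lam y ≠ 0 := by
    have := hfull y
    unfold plam
    positivity
  rw [KL, hterm, if_pos ⟨fun y hy => absurd hy (hpos y), hsum.summable⟩, hsum.tsum_eq, one_mul]

lemma tendsto_log_one_add_mul_exp_neg (c : ℝ) :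
    Tendsto (fun x : ℝ => Real.log (1 + c * Real.exp (-x))) atTop (𝓝 0) := by
  have h : Tendsto (fun x : ℝ => 1 + c * Real.exp (-x)) atTop (𝓝 1) := by
    simpa using (Real.tendsto_exp_neg_atTop_nhds_zero.const_mul c).const_add 1
  simpa using h.log one_ne_zero

/-- For every `λ ∈ ℝ`, the forward KL divergence from the filtered model to
the tilted distribution equals `KL(p*‖p_λ) = log(1 + (A₀/A₁)·e^{−λ})`; in particular,
`KL(p*‖p_λ) → 0` as `λ → +∞`. -/
theorem stmt7
    (a : Y → ℝ) (ha : IsPMF a) (hfull : ∀ y, 0 < a y)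
    (v : Y → ℝ) (hv : ∀ y, v y = 0 ∨ v y = 1)
    (hY1 : ∃ y, v y = 1) (hY0 : ∃ y, v y = 0)
    (hA1 : 0 < A1 a v ∧ A1 a v < 1) :
    (∀ lam : ℝ, KL (pstar a v) (plam a v lam)
        = ((Real.log (1 + (A0 a v / A1 a v) * Real.exp (-lam)) : ℝ) : EReal)) ∧
    Tendsto (fun lam : ℝ => KL (pstar a v) (plam a v lam)) atTop (𝓝 (0 : EReal)) := by
  have hKL := KL_pstar_plam ha.2.summable hfull hA1.1 (sub_pos.mpr hA1.2)
  refine ⟨hKL, ?_⟩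
  simp_rw [hKL]
  exact EReal.tendsto_coe.mpr (tendsto_log_one_add_mul_exp_neg _)

end
end

section
/- Let r : Y → ℝ be a bounded non-constant reward with m := inf_y r(y) and M := sup_y r(y), and let μ ∈ (m, M) with λ(μ) the unique real number such that E_{p_{λ(μ)}}[r] = μ. Then p_{λ(μ)} is the unique minimizer of KL(q‖a) over the moment slice M_μ := {q : E_q[r] = μ}: for every probability distribution q on Y with E_q[r] = μ and q ≠ p_{λ(μ)}, KL(q‖a) > KL(p_{λ(μ)}‖a). -/
noncomputable section

open scoped BigOperators Classical

variable {Y : Type*} [Countable Y]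

/-- Normalization constant `Z_λ = Σ_y a(y)·e^{λ·r(y)}` of the exponential family. -/
def Zlam (a r : Y → ℝ) (lam : ℝ) : ℝ := ∑' y, a y * Real.exp (lam * r y)

/-- The exponential family member `p_λ(y) = a(y)·e^{λ·r(y)}/Z_λ`. -/
def pexp (a r : Y → ℝ) (lam : ℝ) (y : Y) : ℝ :=
  a y * Real.exp (lam * r y) / Zlam a r lam

/-- The log-partition function `A(λ) = log Z_λ`. -/
def logPart (a r : Y → ℝ) (lam : ℝ) : ℝ := Real.log (Zlam a r lam)

/-- The pointwise Gibbs inequality: `x - z < x log (x / z)` for `x ≠ z`. -/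
theorem sub_lt_mul_log_div {x z : ℝ} (hx : 0 ≤ x) (hz : 0 < z) (hxz : x ≠ z) :
    x - z < x * Real.log (x / z) := by
  rcases hx.eq_or_lt with rfl | hx
  · simpa using hz
  · have hne : z / x ≠ 1 := fun h => hxz ((div_eq_one_iff_eq hx.ne').1 h).symm
    have h := mul_lt_mul_of_pos_left (Real.log_lt_sub_one_of_pos (div_pos hz hx) hne) hx
    have hinv : Real.log (x / z) = -Real.log (z / x) := by
      rw [← Real.log_inv, inv_div]
    have hmul : x * (z / x - 1) = z - x := by field_simp
    rw [hinv]
    linarith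

theorem sub_le_mul_log_div {x z : ℝ} (hx : 0 ≤ x) (hz : 0 < z) :
    x - z ≤ x * Real.log (x / z) := by
  rcases eq_or_ne x z with rfl | hxz
  · simp [div_self hz.ne']
  · exact (sub_lt_mul_log_div hx hz hxz).le

theorem summable_mul_of_abs_le {X : Type*} {q f : X → ℝ} (hq : Summable q) (hq0 : ∀ y, 0 ≤ q y) {C : ℝ}
    (hf : ∀ y, |f y| ≤ C) : Summable fun y => q y * f y := by
  refine Summable.of_norm_bounded (hq.mul_right C) fun y => ?_
  rw [Real.norm_eq_abs, abs_mul, abs_of_nonneg (hq0 y)]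
  exact mul_le_mul_of_nonneg_left (hf y) (hq0 y)

theorem summable_mul_exp {X : Type*} {a r : X → ℝ} (ha : IsPMF a) {C : ℝ} (hC : ∀ y, |r y| ≤ C) (l : ℝ) :
    Summable fun y => a y * Real.exp (l * r y) := by
  refine summable_mul_of_abs_le ha.2.summable ha.1 (C := Real.exp (|l| * C)) fun y => ?_
  rw [abs_of_pos (Real.exp_pos _), Real.exp_le_exp]
  calc l * r y ≤ |l * r y| := le_abs_self _
    _ = |l| * |r y| := abs_mul _ _
    _ ≤ |l| * C := mul_le_mul_of_nonneg_left (hC y) (abs_nonneg l)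

theorem Zlam_pos {X : Type*} [Nonempty X] {a r : X → ℝ} (ha : IsPMF a) (hfull : ∀ y, 0 < a y) {C : ℝ}
    (hC : ∀ y, |r y| ≤ C) (l : ℝ) : 0 < Zlam a r l :=
  (summable_mul_exp ha hC l).tsum_pos (fun y => (mul_pos (hfull y) (Real.exp_pos _)).le)
    (Classical.arbitrary X) (mul_pos (hfull _) (Real.exp_pos _))

theorem isPMF_pexp {X : Type*} [Nonempty X] {a r : X → ℝ} (ha : IsPMF a) (hfull : ∀ y, 0 < a y) {C : ℝ}
    (hC : ∀ y, |r y| ≤ C) (l : ℝ) : IsPMF (pexp a r l) := by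
  have hZ := Zlam_pos ha hfull hC l
  refine ⟨fun y => (div_pos (mul_pos (hfull y) (Real.exp_pos _)) hZ).le, ?_⟩
  have h := (summable_mul_exp ha hC l).hasSum.div_const (Zlam a r l)
  change HasSum (pexp a r l) (Zlam a r l / Zlam a r l) at h
  rwa [div_self hZ.ne'] at h

theorem log_pexp_div {X : Type*} {a r : X → ℝ} (hfull : ∀ y, 0 < a y) {l : ℝ}
    (hZ : 0 < Zlam a r l) (y : X) :
    Real.log (pexp a r l y / a y) = l * r y - logPart a r l := by
  have h : pexp a r l y / a y = Real.exp (l * r y) / Zlam a r l := by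
    have := (hfull y).ne'
    unfold pexp
    field_simp
  rw [h, Real.log_div (Real.exp_pos _).ne' hZ.ne', Real.log_exp, logPart]

/-- Under a probability mass function with `E_q[r] = μ`, the log-density of `p_λ` relative to `a`
has mean `λ μ - A(λ)`. -/
theorem hasSum_mul_log_pexp_div {X : Type*} {a r : X → ℝ} (hfull : ∀ y, 0 < a y) {l : ℝ}
    (hZ : 0 < Zlam a r l) {C : ℝ} (hC : ∀ y, |r y| ≤ C) {q : X → ℝ} (hq : IsPMF q) {μ : ℝ}
    (hμ : ∑' y, q y * r y = μ) :
    HasSum (fun y => q y * Real.log (pexp a r l y / a y)) (l * μ - logPart a r l) := by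
  have hr : HasSum (fun y => q y * r y) μ :=
    hμ ▸ (summable_mul_of_abs_le hq.2.summable hq.1 hC).hasSum
  have h := (hr.mul_left l).sub (hq.2.mul_left (logPart a r l))
  rw [mul_one] at h
  have hfun : (fun y => q y * Real.log (pexp a r l y / a y))
      = fun y => l * (q y * r y) - logPart a r l * q y := by
    funext y
    rw [log_pexp_div hfull hZ]
    ring
  rwa [hfun]

/-- For `μ ∈ (m, M)` and `λ(μ)` the (unique) real number with
`E_{p_{λ(μ)}}[r] = μ`, the distribution `p_{λ(μ)}` is the unique minimizer of `KL(q‖a)`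
over the moment slice `{q : E_q[r] = μ}`. -/
theorem stmt17 [Nonempty Y]
    (a : Y → ℝ) (ha : IsPMF a) (hfull : ∀ y, 0 < a y)
    (r : Y → ℝ) (hbdd : ∃ C, ∀ y, |r y| ≤ C)
    (hnc : ∃ y₁ y₂, r y₁ ≠ r y₂)
    (μ : ℝ) (hμ : μ ∈ Set.Ioo (⨅ y, r y) (⨆ y, r y))
    (lamμ : ℝ) (hlam : (∑' y, pexp a r lamμ y * r y) = μ) :
    ∀ q : Y → ℝ, IsPMF q → (∑' y, q y * r y) = μ → q ≠ pexp a r lamμ →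
      KL (pexp a r lamμ) a < KL q a := by
  obtain ⟨C, hC⟩ := hbdd
  intro q hq hqμ hne
  have hZ := Zlam_pos ha hfull hC lamμ
  have hp := isPMF_pexp ha hfull hC lamμ
  have hp_pos : ∀ y, 0 < pexp a r lamμ y := fun y =>
    div_pos (mul_pos (hfull y) (Real.exp_pos _)) hZ
  have hac : ∀ s : Y → ℝ, ∀ y, a y = 0 → s y = 0 := fun s y h => absurd h (hfull y).ne'
  have hsp := hasSum_mul_log_pexp_div hfull hZ hC hp hlam
  have hsq := hasSum_mul_log_pexp_div hfull hZ hC hq hqμ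
  rw [KL, if_pos ⟨hac _, hsp.summable⟩, hsp.tsum_eq, KL]
  split_ifs with h
  · rw [EReal.coe_lt_coe_iff]
    have hdiff := h.2.hasSum.sub hsq
    have hchain : ∀ y, q y * Real.log (q y / a y) - q y * Real.log (pexp a r lamμ y / a y)
        = q y * Real.log (q y / pexp a r lamμ y) := by
      intro y
      rcases (hq.1 y).eq_or_lt with h0 | h0
      · simp [← h0]
      · rw [Real.log_div h0.ne' (hfull y).ne', Real.log_div (hp_pos y).ne' (hfull y).ne',
          Real.log_div h0.ne' (hp_pos y).ne']
        ring
    simp only [hchain] at hdiff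
    obtain ⟨y₀, hy₀⟩ := Function.ne_iff.1 hne
    have hlt := hasSum_lt (fun y => sub_le_mul_log_div (hq.1 y) (hp_pos y))
      (sub_lt_mul_log_div (hq.1 y₀) (hp_pos y₀) hy₀) (hq.2.sub hp.2) hdiff
    linarith
  · exact EReal.coe_lt_top _

end
end
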